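/- With K = ℚ, c = 2, and F = F^{OI,1} ⊕ F^{OI,1}, let f = x_{1,2}x_{1,1}·e_{π,1} + x_{2,2}x_{2,1}·e_{ρ,2} ∈ F_2 (where π: [1] → [2] is 1 ↦ 2 and ρ: [1] → [2] is 1 ↦ 1), and let g = x_{2,3}x_{2,2}x_{1,1}·e_{σ1,2} − x_{2,3}x_{2,1}x_{1,2}·e_{σ2,2} ∈ F_3 (where σ1, σ2: [1] → [3] are 1 ↦ 2 and 1 ↦ 1 respectively). Then for every natural number n ≥ 3 and every strictly increasing map σ: [3] → [n], the element F(σ)(g) lies in the P_n-submodule of F_n generated by the set {F(ε)(f) : ε ∈ Hom(2,n)}. -/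

import Mathlib

noncomputable section

open MvPolynomial

/-- `P_n = ℚ[x_{i,j} : 1 ≤ i ≤ 2, 1 ≤ j ≤ n]`, the width-`n` component of the
polynomial OI-algebra `P^2` over `ℚ`. -/
abbrev P (n : ℕ) := MvPolynomial (Fin 2 × Fin n) ℚ

/-- The variable `x_{i+1,j+1}` of `P_n` (zero-indexed). -/
def x {n : ℕ} (i : Fin 2) (j : Fin n) : P n := X (i, j)

/-- Index set for the basis of the width-`n` component of `F = F^{OI,1} ⊕ F^{OI,1}`:
a copy of `Hom(1,n)` for each summand. -/
abbrev Idx (n : ℕ) := (Fin 1 ↪o Fin n) ⊕ (Fin 1 ↪o Fin n)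

/-- The width-`n` component `F_n` of `F = F^{OI,1} ⊕ F^{OI,1}`, the free `P_n`-module
with basis `e_{π,1}, e_{π,2}` for `π ∈ Hom(1,n)`. -/
abbrev FF (n : ℕ) := Idx n →₀ P n

/-- Basis element `e_{π,1}` of `F_n`. -/
def e1 {n : ℕ} (π : Fin 1 ↪o Fin n) : FF n := Finsupp.single (Sum.inl π) 1
/-- Basis element `e_{π,2}` of `F_n`. -/
def e2 {n : ℕ} (π : Fin 1 ↪o Fin n) : FF n := Finsupp.single (Sum.inr π) 1

/-- The structure map `F(ε) : F_m → F_n`, sending `a·e_{π,i}` to `ε_*(a)·e_{ε∘π,i}`. -/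
def Fmap {m n : ℕ} (ε : Fin m ↪o Fin n) (v : FF m) : FF n :=
  v.sum fun i a =>
    Finsupp.single
      (Sum.map (fun π => π.trans ε) (fun π => π.trans ε) i)
      (rename (Prod.map id ⇑ε) a)

/-- `π : [1] → [2]`, `1 ↦ 2`. -/
def π : Fin 1 ↪o Fin 2 := Finset.orderEmbOfFin ({1} : Finset (Fin 2)) (by decide)
/-- `ρ : [1] → [2]`, `1 ↦ 1`. -/
def ρ : Fin 1 ↪o Fin 2 := Finset.orderEmbOfFin ({0} : Finset (Fin 2)) (by decide)
/-- `σ1 : [1] → [3]`, `1 ↦ 2`. -/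
def σ1 : Fin 1 ↪o Fin 3 := Finset.orderEmbOfFin ({1} : Finset (Fin 3)) (by decide)
/-- `σ2 : [1] → [3]`, `1 ↦ 1`. -/
def σ2 : Fin 1 ↪o Fin 3 := Finset.orderEmbOfFin ({0} : Finset (Fin 3)) (by decide)

/-- `f = x_{1,2}x_{1,1}·e_{π,1} + x_{2,2}x_{2,1}·e_{ρ,2} ∈ F_2`. -/
def f : FF 2 := (x 0 1 * x 0 0 : P 2) • e1 π + (x 1 1 * x 1 0 : P 2) • e2 ρ

/-- `g = x_{2,3}x_{2,2}x_{1,1}·e_{σ1,2} − x_{2,3}x_{2,1}x_{1,2}·e_{σ2,2} ∈ F_3`. -/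
def g : FF 3 :=
  (x 1 2 * x 1 1 * x 0 0 : P 3) • e2 σ1 - (x 1 2 * x 1 0 * x 0 1 : P 3) • e2 σ2

theorem Fmap_add' {m n : ℕ} (ε : Fin m ↪o Fin n) (v w : FF m) :
    Fmap ε (v + w) = Fmap ε v + Fmap ε w := by
  unfold Fmap
  apply Finsupp.sum_add_index'
  · intro a; simp
  · intro a b c; simp

theorem Fmap_sub' {m n : ℕ} (ε : Fin m ↪o Fin n) (v w : FF m) :
    Fmap ε (v - w) = Fmap ε v - Fmap ε w := by
  rw [eq_sub_iff_add_eq, ← Fmap_add', sub_add_cancel]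

theorem Fmap_smul_e1 {m n : ℕ} (ε : Fin m ↪o Fin n) (a : P m) (τ : Fin 1 ↪o Fin m) :
    Fmap ε (a • e1 τ) = rename (Prod.map id ⇑ε) a • e1 (τ.trans ε) := by
  simp [Fmap, e1, Finsupp.smul_single, Finsupp.sum_single_index]

theorem Fmap_smul_e2 {m n : ℕ} (ε : Fin m ↪o Fin n) (a : P m) (τ : Fin 1 ↪o Fin m) :
    Fmap ε (a • e2 τ) = rename (Prod.map id ⇑ε) a • e2 (τ.trans ε) := by
  simp [Fmap, e2, Finsupp.smul_single, Finsupp.sum_single_index]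

theorem rename_x' {m n : ℕ} (ε : Fin m ↪o Fin n) (i : Fin 2) (j : Fin m) :
    rename (Prod.map id ⇑ε) (x i j : P m) = x i (ε j) := by
  simp [x]

/-- The map `[2] → [3]` with image `{2,3}`. -/
def d12 : Fin 2 ↪o Fin 3 := OrderEmbedding.ofStrictMono ![1, 2] (by decide)
/-- The map `[2] → [3]` with image `{1,3}`. -/
def d02 : Fin 2 ↪o Fin 3 := OrderEmbedding.ofStrictMono ![0, 2] (by decide)

theorem hom1_ext {n : ℕ} {a b : Fin 1 ↪o Fin n} (h : a 0 = b 0) : a = b := by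
  ext i
  rw [Subsingleton.elim i 0, h]

theorem π_zero : π 0 = 1 := by simp [π]
theorem ρ_zero : ρ 0 = 0 := by simp [ρ]
theorem σ1_zero : σ1 0 = 1 := by simp [σ1]
theorem σ2_zero : σ2 0 = 0 := by simp [σ2]

/-- for every `n ≥ 3` and every strictly increasing map `σ : [3] → [n]`,
the element `F(σ)(g)` lies in the `P_n`-submodule of `F_n` generated by the set of all
images `F(ε)(f)` for `ε ∈ Hom(2,n)`. -/
theorem Fmap_g_mem_span (n : ℕ) (hn : 3 ≤ n) (σ : Fin 3 ↪o Fin n) :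
    Fmap σ g ∈ Submodule.span (P n) {v | ∃ ε : Fin 2 ↪o Fin n, v = Fmap ε f} := by
  have key : Fmap σ g = x 0 (σ 0) • Fmap (d12.trans σ) f - x 0 (σ 1) • Fmap (d02.trans σ) f := by
    have h1 : σ1.trans σ = ρ.trans (d12.trans σ) :=
      hom1_ext (by simp [σ1_zero, ρ_zero, d12])
    have h2 : σ2.trans σ = ρ.trans (d02.trans σ) :=
      hom1_ext (by simp [σ2_zero, ρ_zero, d02])
    have h3 : π.trans (d02.trans σ) = π.trans (d12.trans σ) :=
      hom1_ext (by simp [π_zero, d12, d02])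
    have a0 : (d12.trans σ) 0 = σ 1 := by simp [d12]
    have a1 : (d12.trans σ) 1 = σ 2 := by simp [d12]
    have b0 : (d02.trans σ) 0 = σ 0 := by simp [d02]
    have b1 : (d02.trans σ) 1 = σ 2 := by simp [d02]
    unfold f g
    simp only [Fmap_sub', Fmap_add', Fmap_smul_e1, Fmap_smul_e2, map_mul, rename_x',
      a0, a1, b0, b1, h1, h2, h3]
    module
  rw [key]
  exact Submodule.sub_mem _
    (Submodule.smul_mem _ _ (Submodule.subset_span ⟨_, rfl⟩))
    (Submodule.smul_mem _ _ (Submodule.subset_span ⟨_, rfl⟩))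

end
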